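/- Let ξ, η ∈ ℝ³ with η ≠ 0 and ξ − η ≠ 0. Then |∇H(η) + ∇H(ξ−η)| ≥ √2 · |η × ξ| / (|η|·|ξ−η|), where ∇H(x) = H'(|x|)·x/|x| and × is the cross product in ℝ³. (This is the improved spatial non-resonance lower bound for the phase Ω₊₋, whose η-gradient equals ∇H(η) + ∇H(ξ−η); it uses η × (ξ−η) = η × ξ and the lower bound H'(r) ≥ √2.) -/

import Mathlib

/-- The gradient `∇H(x) = H'(|x|)·x/|x|` with `H'(r) = (2+2r²)/√(2+r²)` of the dispersion
relation `H(ξ) = |ξ|√(2+|ξ|²)`. -/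
noncomputable def gradH (x : EuclideanSpace ℝ (Fin 3)) : EuclideanSpace ℝ (Fin 3) :=
  ((2 + 2 * ‖x‖ ^ 2) / Real.sqrt (2 + ‖x‖ ^ 2) / ‖x‖) • x

/-- The cross product on `EuclideanSpace ℝ (Fin 3)`. -/
noncomputable def cross3 (u v : EuclideanSpace ℝ (Fin 3)) : EuclideanSpace ℝ (Fin 3) :=
  (WithLp.equiv 2 (Fin 3 → ℝ)).symm
    (crossProduct ((WithLp.equiv 2 (Fin 3 → ℝ)) u) ((WithLp.equiv 2 (Fin 3 → ℝ)) v))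

theorem norm_sq_cross3 (u v : EuclideanSpace ℝ (Fin 3)) :
    ‖cross3 u v‖ ^ 2 =
      (u 1 * v 2 - u 2 * v 1) ^ 2 + (u 2 * v 0 - u 0 * v 2) ^ 2 +
        (u 0 * v 1 - u 1 * v 0) ^ 2 := by
  simp [EuclideanSpace.real_norm_sq_eq, Fin.sum_univ_three, cross3, cross_apply]

theorem norm_cross3_le (u v : EuclideanSpace ℝ (Fin 3)) : ‖cross3 u v‖ ≤ ‖u‖ * ‖v‖ := by
  refine le_of_sq_le_sq ?_ (by positivity)
  rw [mul_pow, norm_sq_cross3, EuclideanSpace.real_norm_sq_eq, EuclideanSpace.real_norm_sq_eq,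
    Fin.sum_univ_three, Fin.sum_univ_three]
  linarith [sq_nonneg (u 0 * v 0 + u 1 * v 1 + u 2 * v 2)]

theorem cross3_smul_add_smul_sub (a b : ℝ) (u v : EuclideanSpace ℝ (Fin 3)) :
    cross3 u (a • u + b • (v - u)) = b • cross3 u v := by
  ext i
  fin_cases i <;> simp [cross3, cross_apply] <;> ring

theorem sqrt_two_le_radial_deriv (r : ℝ) :
    Real.sqrt 2 ≤ (2 + 2 * r ^ 2) / Real.sqrt (2 + r ^ 2) := by
  rw [le_div_iff₀ (by positivity), ← Real.sqrt_mul (by norm_num)]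
  exact Real.sqrt_le_iff.mpr ⟨by positivity, by nlinarith [sq_nonneg r, sq_nonneg (r ^ 2)]⟩

/-- Improved spatial non-resonance lower bound:
`|∇H(η) + ∇H(ξ−η)| ≥ √2·|η × ξ|/(|η||ξ−η|)` for `η ≠ 0`, `ξ−η ≠ 0`. -/
theorem gradient_sum_lower_bound (ξ η : EuclideanSpace ℝ (Fin 3))
    (hη : η ≠ 0) (hξη : ξ - η ≠ 0) :
    Real.sqrt 2 * ‖cross3 η ξ‖ / (‖η‖ * ‖ξ - η‖) ≤ ‖gradH η + gradH (ξ - η)‖ := by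
  have hη_pos : 0 < ‖η‖ := norm_pos_iff.mpr hη
  have hξη_pos : 0 < ‖ξ - η‖ := norm_pos_iff.mpr hξη
  have hcross := norm_cross3_le η (gradH η + gradH (ξ - η))
  rw [gradH, gradH, cross3_smul_add_smul_sub, norm_smul, ← gradH, ← gradH,
    Real.norm_of_nonneg (by positivity)] at hcross
  calc Real.sqrt 2 * ‖cross3 η ξ‖ / (‖η‖ * ‖ξ - η‖)
      = Real.sqrt 2 / ‖ξ - η‖ * ‖cross3 η ξ‖ / ‖η‖ := by field_simp
    _ ≤ (2 + 2 * ‖ξ - η‖ ^ 2) / Real.sqrt (2 + ‖ξ - η‖ ^ 2) / ‖ξ - η‖ * ‖cross3 η ξ‖ / ‖η‖ := by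
        gcongr
        exact sqrt_two_le_radial_deriv _
    _ ≤ ‖gradH η + gradH (ξ - η)‖ := by
        rwa [div_le_iff₀' hη_pos]
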